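/- Let δ be a local congruence on a lattice L such that every δ-cycle is closed, and let ρ_δ be the relation on L defined by (x,y) ∈ ρ_δ iff [x]_δ ≼_δ [y]_δ and [y]_δ ≼_δ [x]_δ. Then ρ_δ equals δ. -/

import Mathlib

variable {L : Type*}

def LocalCong [Lattice L] (δ : L → L → Prop) : Prop :=
  Equivalence δ ∧
  (∀ x a b, δ x a → δ x b → δ x (a ⊔ b) ∧ δ x (a ⊓ b)) ∧
  (∀ x a b c, δ x a → δ x b → a ≤ c → c ≤ b → δ x c)

def lstep [Lattice L] (δ : L → L → Prop) : L → L → Prop :=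
  fun a b => δ a b ∨ a ≤ b

def classLe [Lattice L] (δ : L → L → Prop) (x y : L) : Prop :=
  ∃ x' y', δ x x' ∧ δ y y' ∧ Relation.ReflTransGen (lstep δ) x' y'

def ClosedCycles [Lattice L] (δ : L → L → Prop) : Prop :=
  ∀ l : List L, l.Chain' (lstep δ) → 2 ≤ l.length → l.head? = l.getLast? →
    ∀ a ∈ l, ∀ b ∈ l, δ a b

theorem stmt19 [Lattice L] (δ : L → L → Prop) (h : LocalCong δ)
    (hc : ClosedCycles δ) :
    ∀ x y, (classLe δ x y ∧ classLe δ y x) ↔ δ x y := by 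
  obtain ⟨heq, -, -⟩ := h
  have lift : ∀ x y, classLe δ x y → Relation.ReflTransGen (lstep δ) x y := by
    rintro x y ⟨x', y', hx, hy, hr⟩
    have s1 : lstep δ x x' := Or.inl hx
    have s2 : lstep δ y' y := Or.inl (heq.symm hy)
    exact (Relation.ReflTransGen.head s1 hr).tail s2
  intro x y
  constructor
  · rintro ⟨h1, h2⟩
    obtain ⟨l1, c1, e1⟩ := List.exists_isChain_cons_of_relationReflTransGen (lift x y h1)
    obtain ⟨l2, c2, e2⟩ := List.exists_isChain_cons_of_relationReflTransGen (lift y x h2)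
    have g1 : (x :: l1).getLast? = some y := by
      rw [List.getLast?_eq_getLast_of_ne_nil (List.cons_ne_nil _ _), e1]
    have g2 : (y :: l2).getLast? = some x := by
      rw [List.getLast?_eq_getLast_of_ne_nil (List.cons_ne_nil _ _), e2]
    refine hc ((x :: l1) ++ (y :: l2)) ?_ ?_ ?_ x (by simp) y (by simp)
    · refine List.IsChain.append c1 c2 ?_
      intro a ha b hb
      rw [g1] at ha
      simp at ha hb
      subst ha; subst hb
      exact Or.inr le_rfl
    · simp; omega
    · rw [List.getLast?_append, g2]; simp
  · intro hxy
    exact ⟨⟨x, x, heq.refl x, heq.symm hxy, .refl⟩, ⟨x, x, heq.symm hxy, heq.refl x, .refl⟩⟩
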